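/- Let e ≥ 2 and r ≥ 2 be integers. Suppose c ≤ d are integers, let u_1 > … > u_n be the elements of {c, c+1, …, d} ∩ 𝟙_r in decreasing order, let v_1 > … > v_m be elements of {c, c+1, …, d} ∖ 𝟙_r, and let t_1 > … > t_{m+n} be the elements of {v_1,…,v_m} ∪ {u_1,…,u_n} in decreasing order. Then in the (m+n)-wedge space Λ^{m+n}_{e,r}: |u_1⟩∧…∧|u_n⟩∧|v_1⟩∧…∧|v_m⟩ = (Π_{i=1}^m (−1)^{X_c(v_i)} q^{Y_c(v_i)}) · |t_1⟩∧…∧|t_{m+n}⟩. -/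

import Mathlib

noncomputable section

/-- The field `ℚ(q)` of rational functions. -/
abbrev K : Type := RatFunc ℚ

/-- The element `q` of `ℚ(q)`. -/
def qK : K := RatFunc.X

/-- `a_{r'}(t)`: the unique element of `{1,…,e}` congruent to `t` modulo `e`
(this does not depend on `r'`). -/
def aFun (e t : ℤ) : ℤ := (t - 1) % e + 1

/-- `b_{r'}(t)`: the unique element of `{1,…,r'}` such that
`t = a_{r'}(t) + e (b_{r'}(t) − 1) − e r' m` for some integer `m`. -/
def bFun (e r t : ℤ) : ℤ := (t - 1) % (e * r) / e + 1

/-- `m_{r'}(t)`: the unique integer with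
`t = a_{r'}(t) + e (b_{r'}(t) − 1) − e r' m_{r'}(t)`. -/
def mFun (e r t : ℤ) : ℤ := (aFun e t + e * (bFun e r t - 1) - t) / (e * r)

/-- The free `ℚ(q)`-module on the set of `l`-tuples of integers
(the basis element at `(t₁,…,t_l)` is the formal wedge `|t₁⟩∧…∧|t_l⟩`). -/
abbrev FW (l : ℕ) := (Fin l → ℤ) →₀ K

/-- The formal two-entry wedge `|x⟩∧|y⟩` in the free module on pairs. -/
def pairTerm (x y : ℤ) : (ℤ × ℤ) →₀ K := Finsupp.single (x, y) 1

/-- The sum `Σ_{m ≥ m0} coeff m · |u−γ−Nm⟩∧|t+γ+Nm⟩`, where `m` ranges only over those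
values for which the displayed wedge is ordered (first entry strictly bigger).  Since
`N ≥ 2` and `γ ≥ 0` in all uses, all such `m` satisfy `m ≤ (u−t).toNat`, so the
following finite sum captures all of them. -/
def pairSum (N t u γ : ℤ) (m0 : ℕ) (coeff : ℕ → K) : (ℤ × ℤ) →₀ K :=
  ∑ m ∈ Finset.Ico m0 ((u - t).toNat + 1),
    if t + γ + N * m < u - γ - N * m then coeff m • pairTerm (u - γ - N * m) (t + γ + N * m)
    else 0

/-- For `t ≤ u`, the right-hand side of the straightening relation for `|t⟩∧|u⟩`
in the wedge space with parameters `e, r`. -/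
def pairRHS (e r t u : ℤ) : (ℤ × ℤ) →₀ K :=
  let N := e * r
  let α := (aFun e u - aFun e t) % N
  let β := (e * (bFun e r u - bFun e r t)) % N
  if α = 0 ∧ β = 0 then -pairTerm u t
  else if β = 0 then
    -(qK⁻¹ • pairTerm u t) +
      (qK ^ (-2 : ℤ) - 1) •
        (pairSum N t u α 0 (fun m => qK ^ (-2 * (m : ℤ))) -
          pairSum N t u 0 1 (fun m => qK ^ (1 - 2 * (m : ℤ))))
  else if α = 0 then
    -(qK • pairTerm u t) +
      (qK ^ (2 : ℤ) - 1) •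
        (pairSum N t u β 0 (fun m => qK ^ (2 * (m : ℤ))) -
          pairSum N t u 0 1 (fun m => qK ^ (2 * (m : ℤ) - 1)))
  else
    -pairTerm u t +
      (qK - qK⁻¹) • pairSum N t u β 0
        (fun m => (qK ^ (2 * (m : ℤ) + 1) + qK ^ (-2 * (m : ℤ) - 1)) / (qK + qK⁻¹)) +
      (qK⁻¹ - qK) • pairSum N t u α 0
        (fun m => (qK ^ (2 * (m : ℤ) + 1) + qK ^ (-2 * (m : ℤ) - 1)) / (qK + qK⁻¹)) +
      (qK - qK⁻¹) • pairSum N t u (α + β) 0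
        (fun m => (qK ^ (2 * (m : ℤ) + 2) - qK ^ (-2 * (m : ℤ) - 2)) / (qK + qK⁻¹)) +
      (qK⁻¹ - qK) • pairSum N t u 0 1
        (fun m => (qK ^ (2 * (m : ℤ)) - qK ^ (-2 * (m : ℤ))) / (qK + qK⁻¹))

/-- Replace the entries of an `l`-tuple at positions `j` and `j+1` by `p.1` and `p.2`. -/
def updPair (l : ℕ) (ts : Fin l → ℤ) (j : ℕ) (p : ℤ × ℤ) : Fin l → ℤ :=
  fun i => if (i : ℕ) = j then p.1 else if (i : ℕ) = j + 1 then p.2 else ts i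

/-- The set of straightening relators: for every `l`-tuple `ts` and every pair of
adjacent positions `j, j+1` with `ts j ≤ ts (j+1)`, the element
`|ts⟩ − (RHS of the straightening relation applied at positions j, j+1)`. -/
def relSet (e r : ℤ) (l : ℕ) : Set (FW l) :=
  {x | ∃ (ts : Fin l → ℤ) (j j' : Fin l), (j' : ℕ) = (j : ℕ) + 1 ∧ ts j ≤ ts j' ∧
      x = Finsupp.single ts 1 -
        (pairRHS e r (ts j) (ts j')).sum fun p c => Finsupp.single (updPair l ts (j : ℕ) p) c}

/-- The `l`-wedge space `Λ^l_{e,r}`: the quotient of the free module on `l`-tuples by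
the straightening relations. -/
abbrev WedgeSpace (e r : ℤ) (l : ℕ) := FW l ⧸ Submodule.span K (relSet e r l)

/-- The image of the wedge `|ts 0⟩∧…∧|ts (l−1)⟩` in the `l`-wedge space. -/
def wedge (e r : ℤ) (l : ℕ) (ts : Fin l → ℤ) : WedgeSpace e r l :=
  Submodule.Quotient.mk (Finsupp.single ts 1)

/-- `X_c(v) = |{c, …, v} ∩ 𝟙_r|`. -/
def Xc (e r c v : ℤ) : ℕ := ((Finset.Icc c v).filter fun t => bFun e r t = 1).card

/-- `Y_c(v) = |{c, …, v} ∩ 𝟙_r ∩ (v + eℤ)}|`. -/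
def Yc (e r c v : ℤ) : ℕ :=
  ((Finset.Icc c v).filter fun t => bFun e r t = 1 ∧ t % e = v % e).card

/-- The `(m+n)`-tuple `(u₁, …, u_n, v₁, …, v_m)` (0-based: `u_j` is `u (j-1)`). -/
def concatFwd (n m : ℕ) (u : Fin n → ℤ) (v : Fin m → ℤ) : Fin (m + n) → ℤ := fun i =>
  if h : (i : ℕ) < n then u ⟨(i : ℕ), h⟩ else v ⟨(i : ℕ) - n, by have := i.2; omega⟩

lemma qK_ne_zero : qK ≠ 0 := RatFunc.X_ne_zero

lemma aFun_pos {e : ℤ} (he : 0 < e) (t : ℤ) : 1 ≤ aFun e t := by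
  have := Int.emod_nonneg (t - 1) he.ne'
  unfold aFun; omega

lemma aFun_le {e : ℤ} (he : 0 < e) (t : ℤ) : aFun e t ≤ e := by
  have := Int.emod_lt_of_pos (t - 1) he
  unfold aFun; omega

lemma bFun_pos {e r : ℤ} (he : 0 < e) (hr : 0 < r) (t : ℤ) : 1 ≤ bFun e r t := by
  have := Int.ediv_nonneg (Int.emod_nonneg (t - 1) (mul_pos he hr).ne') he.le
  unfold bFun; omega

lemma bFun_le {e r : ℤ} (he : 0 < e) (hr : 0 < r) (t : ℤ) : bFun e r t ≤ r := by
  have := Int.ediv_lt_of_lt_mul he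
    ((Int.emod_lt_of_pos (t - 1) (mul_pos he hr)).trans_eq (mul_comm e r))
  unfold bFun; omega

lemma exists_eq_aFun_add_bFun (e r t : ℤ) :
    ∃ k, t = aFun e t + e * (bFun e r t - 1) + e * r * k := by
  refine ⟨(t - 1) / (e * r), ?_⟩
  have h1 := Int.emod_add_mul_ediv (t - 1) (e * r)
  have h2 := Int.emod_add_mul_ediv ((t - 1) % (e * r)) e
  rw [Int.emod_emod_of_dvd _ (dvd_mul_right e r)] at h2
  unfold aFun bFun
  linarith

lemma bFun_eq_of_eq {e r a b x k : ℤ} (he : 0 < e) (ha : 1 ≤ a) (ha' : a ≤ e)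
    (hb : 1 ≤ b) (hb' : b ≤ r) (h : x = a + e * (b - 1) + e * r * k) : bFun e r x = b := by
  have h1 : x - 1 = (a - 1 + e * (b - 1)) + e * r * k := by linarith
  have h2 : e * (b - 1) ≤ e * (r - 1) := by gcongr
  have h3 : 0 ≤ e * (b - 1) := by apply mul_nonneg <;> omega
  rw [bFun, h1, Int.add_mul_emod_self_left, Int.emod_eq_of_lt (by linarith) (by linarith),
    Int.add_mul_ediv_left _ _ he.ne', Int.ediv_eq_zero_of_lt (by omega) (by omega)]
  ring

/-- Pairs that may occur, besides `(u, t)`, when straightening `|t⟩∧|u⟩`. -/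
def innerPairs (e r t u : ℤ) : Set (ℤ × ℤ) :=
  {p | t < p.2 ∧ p.2 < p.1 ∧ p.1 + p.2 = t + u ∧
    ((bFun e r p.1 = bFun e r u ∧ bFun e r p.2 = bFun e r t) ∨
      (bFun e r p.1 = bFun e r t ∧ bFun e r p.2 = bFun e r u))}

lemma pairSum_mem_supported {e r t u γ : ℤ} {m0 : ℕ} (hN : 0 < e * r) (hγ : 0 ≤ γ)
    (hpos : 0 < γ ∨ 0 < m0)
    (hb : ∀ m : ℤ,
      (bFun e r (u - γ - e * r * m) = bFun e r u ∧ bFun e r (t + γ + e * r * m) = bFun e r t) ∨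
      (bFun e r (u - γ - e * r * m) = bFun e r t ∧ bFun e r (t + γ + e * r * m) = bFun e r u))
    (coeff : ℕ → K) :
    pairSum (e * r) t u γ m0 coeff ∈ Finsupp.supported K K (innerPairs e r t u) := by
  unfold pairSum
  refine Submodule.sum_mem _ fun m hm => ?_
  split_ifs with h
  · refine Submodule.smul_mem _ _ (Finsupp.single_mem_supported K 1 ?_)
    refine ⟨?_, h, by ring, hb m⟩
    have h0 : 0 ≤ e * r * (m : ℤ) := by positivity
    rcases hpos with hpos | hpos
    · simp only; omega
    · have hm' : 0 < m := hpos.trans_le (Finset.mem_Ico.mp hm).1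
      have : 0 < e * r * (m : ℤ) := by positivity
      simp only; omega
  · exact Submodule.zero_mem _

lemma exists_pairRHS_eq {e r : ℤ} (he : 2 ≤ e) (hr : 2 ≤ r) (t u : ℤ) :
    ∃ κ : K, κ ≠ 0 ∧ (bFun e r t ≠ bFun e r u → κ = if t % e = u % e then -qK else -1) ∧
      pairRHS e r t u - κ • pairTerm u t ∈ Finsupp.supported K K (innerPairs e r t u) := by
  have he0 : 0 < e := by omega
  have hr0 : 0 < r := by omega
  have hN : 0 < e * r := mul_pos he0 hr0
  have heN : e < e * r := by nlinarith
  have ha1 := aFun_pos he0 t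
  have ha2 := aFun_le he0 t
  have ha3 := aFun_pos he0 u
  have ha4 := aFun_le he0 u
  have hb1 := bFun_pos he0 hr0 t
  have hb2 := bFun_le he0 hr0 t
  have hb3 := bFun_pos he0 hr0 u
  have hb4 := bFun_le he0 hr0 u
  obtain ⟨kt, hkt⟩ := exists_eq_aFun_add_bFun e r t
  obtain ⟨ku, hku⟩ := exists_eq_aFun_add_bFun e r u
  have hα0 := Int.emod_nonneg (aFun e u - aFun e t) hN.ne'
  have hβ0 := Int.emod_nonneg (e * (bFun e r u - bFun e r t)) hN.ne'
  have hα := Int.emod_add_mul_ediv (aFun e u - aFun e t) (e * r)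
  have hβ := Int.emod_add_mul_ediv (e * (bFun e r u - bFun e r t)) (e * r)
  have hαz : (aFun e u - aFun e t) % (e * r) = 0 ↔ t % e = u % e := by
    constructor
    · intro h
      have := Int.eq_zero_of_abs_lt_dvd (Int.dvd_of_emod_eq_zero h) (by rw [abs_lt]; omega)
      unfold aFun at this
      have h5 : (t - 1) ≡ (u - 1) [ZMOD e] := by unfold Int.ModEq; omega
      have h6 := h5.add_right 1
      rwa [sub_add_cancel, sub_add_cancel] at h6
    · intro h
      have h5 : t ≡ u [ZMOD e] := h
      have h6 := h5.sub_right 1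
      unfold Int.ModEq at h6
      simp [aFun, h6]
  have hβz : (e * (bFun e r u - bFun e r t)) % (e * r) = 0 ↔ bFun e r t = bFun e r u := by
    constructor
    · intro h
      have h5 := Int.dvd_of_emod_eq_zero h
      have := Int.eq_zero_of_abs_lt_dvd ((mul_dvd_mul_iff_left he0.ne').mp h5)
        (by rw [abs_lt]; omega)
      omega
    · intro h
      simp [h]
  have Sα : ∀ m : ℤ, bFun e r (u - (aFun e u - aFun e t) % (e * r) - e * r * m) = bFun e r u ∧
      bFun e r (t + (aFun e u - aFun e t) % (e * r) + e * r * m) = bFun e r t := fun m =>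
    ⟨bFun_eq_of_eq (k := ku + (aFun e u - aFun e t) / (e * r) - m) he0 ha1 ha2 hb3 hb4
        (by linarith),
      bFun_eq_of_eq (k := kt - (aFun e u - aFun e t) / (e * r) + m) he0 ha3 ha4 hb1 hb2
        (by linarith)⟩
  have Sβ : ∀ m : ℤ,
      bFun e r (u - (e * (bFun e r u - bFun e r t)) % (e * r) - e * r * m) = bFun e r t ∧
      bFun e r (t + (e * (bFun e r u - bFun e r t)) % (e * r) + e * r * m) = bFun e r u := fun m =>
    ⟨bFun_eq_of_eq (k := ku + (e * (bFun e r u - bFun e r t)) / (e * r) - m) he0 ha3 ha4 hb1 hb2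
        (by linarith),
      bFun_eq_of_eq (k := kt - (e * (bFun e r u - bFun e r t)) / (e * r) + m) he0 ha1 ha2 hb3 hb4
        (by linarith)⟩
  have Sαβ : ∀ m : ℤ,
      bFun e r (u - ((aFun e u - aFun e t) % (e * r) +
        (e * (bFun e r u - bFun e r t)) % (e * r)) - e * r * m) = bFun e r t ∧
      bFun e r (t + ((aFun e u - aFun e t) % (e * r) +
        (e * (bFun e r u - bFun e r t)) % (e * r)) + e * r * m) = bFun e r u := fun m =>
    ⟨bFun_eq_of_eq (k := ku + (aFun e u - aFun e t) / (e * r) +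
          (e * (bFun e r u - bFun e r t)) / (e * r) - m) he0 ha1 ha2 hb1 hb2 (by linarith),
      bFun_eq_of_eq (k := kt - (aFun e u - aFun e t) / (e * r) -
          (e * (bFun e r u - bFun e r t)) / (e * r) + m) he0 ha3 ha4 hb3 hb4 (by linarith)⟩
  have S0 : ∀ m : ℤ, bFun e r (u - 0 - e * r * m) = bFun e r u ∧
      bFun e r (t + 0 + e * r * m) = bFun e r t := fun m =>
    ⟨bFun_eq_of_eq (k := ku - m) he0 ha3 ha4 hb3 hb4 (by linarith),
      bFun_eq_of_eq (k := kt + m) he0 ha1 ha2 hb1 hb2 (by linarith)⟩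
  have M0 := pairSum_mem_supported (m0 := 1) hN le_rfl (Or.inr one_pos) fun m => Or.inl (S0 m)
  simp only [pairRHS, hαz, hβz]
  generalize (aFun e u - aFun e t) % (e * r) = α at *
  generalize (e * (bFun e r u - bFun e r t)) % (e * r) = β at *
  have Mα := fun h : ¬ t % e = u % e => pairSum_mem_supported (m0 := 0) hN hα0
    (Or.inl (lt_of_le_of_ne hα0 (Ne.symm (mt hαz.mp h)))) fun m => Or.inl (Sα m)
  have Mβ := fun h : ¬ bFun e r t = bFun e r u => pairSum_mem_supported (m0 := 0) hN hβ0
    (Or.inl (lt_of_le_of_ne hβ0 (Ne.symm (mt hβz.mp h)))) fun m => Or.inr (Sβ m)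
  have Mαβ := fun h : ¬ t % e = u % e => pairSum_mem_supported (m0 := 0) hN
    (add_nonneg hα0 hβ0) (Or.inl (add_pos_of_pos_of_nonneg
      (lt_of_le_of_ne hα0 (Ne.symm (mt hαz.mp h))) hβ0)) fun m => Or.inr (Sαβ m)
  by_cases h1 : bFun e r t = bFun e r u <;> by_cases h2 : t % e = u % e <;>
    simp only [h1, h2, and_true, and_false, if_true, if_false]
  · exact ⟨-1, by simp, fun h => absurd rfl h, by simp⟩
  · refine ⟨-qK⁻¹, neg_ne_zero.mpr (inv_ne_zero qK_ne_zero), fun h => absurd rfl h, ?_⟩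
    rw [neg_smul, add_sub_cancel_left]
    exact Submodule.smul_mem _ _ (Submodule.sub_mem _ (Mα h2 _) (M0 _))
  · refine ⟨-qK, neg_ne_zero.mpr qK_ne_zero, fun _ => rfl, ?_⟩
    rw [neg_smul, add_sub_cancel_left]
    exact Submodule.smul_mem _ _ (Submodule.sub_mem _ (Mβ h1 _) (M0 _))
  · refine ⟨-1, by simp, fun _ => rfl, ?_⟩
    rw [neg_smul, one_smul, add_assoc, add_assoc, add_assoc, add_sub_cancel_left]
    exact Submodule.add_mem _ (Submodule.smul_mem _ _ (Mβ h1 _))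
      (Submodule.add_mem _ (Submodule.smul_mem _ _ (Mα h2 _))
        (Submodule.add_mem _ (Submodule.smul_mem _ _ (Mαβ h2 _))
          (Submodule.smul_mem _ _ (M0 _))))

lemma pairRHS_self (e r t : ℤ) : pairRHS e r t t = -pairTerm t t := by
  simp [pairRHS]

/-- A family of vectors indexed by lists of integers satisfying the straightening relations
in every pair of adjacent positions. -/
def IsStraightening {M : Type*} [AddCommGroup M] [Module K M] (e r : ℤ) (f : List ℤ → M) : Prop :=
  ∀ (P Q : List ℤ) (x y : ℤ), x ≤ y →
    f (P ++ x :: y :: Q) =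
      Finsupp.linearCombination K (fun p : ℤ × ℤ => f (P ++ p.1 :: p.2 :: Q)) (pairRHS e r x y)

namespace IsStraightening

variable {M : Type*} [AddCommGroup M] [Module K M] {e r : ℤ} {f : List ℤ → M}

lemma context (hf : IsStraightening e r f) (A B : List ℤ) :
    IsStraightening e r fun L => f (A ++ L ++ B) := by
  intro P Q x y hxy
  simpa using hf (A ++ P) (Q ++ B) x y hxy

/-- If all inner pairs vanish, straightening only swaps the two entries up to a scalar. -/
lemma exists_pair_eq_smul (hf : IsStraightening e r f) (he : 2 ≤ e) (hr : 2 ≤ r) {t u : ℤ}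
    (htu : t ≤ u) (h0 : ∀ p ∈ innerPairs e r t u, f [p.1, p.2] = 0) :
    ∃ κ : K, κ ≠ 0 ∧ (bFun e r t ≠ bFun e r u → κ = if t % e = u % e then -qK else -1) ∧
      f [t, u] = κ • f [u, t] := by
  obtain ⟨κ, hκ, hκ', hmem⟩ := exists_pairRHS_eq he hr t u
  refine ⟨κ, hκ, hκ', ?_⟩
  have h1 := hf [] [] t u htu
  simp only [List.nil_append] at h1
  have h2 : Finsupp.linearCombination K (fun p : ℤ × ℤ => f [p.1, p.2])
      (pairRHS e r t u - κ • pairTerm u t) = 0 := by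
    rw [Finsupp.linearCombination_apply]
    refine Finset.sum_eq_zero fun p hp => ?_
    simp only [h0 p (hmem hp), smul_zero]
  rw [map_sub, ← h1, map_smul, pairTerm, Finsupp.linearCombination_single, one_smul,
    sub_eq_zero] at h2
  exact h2

lemma pair_self (hf : IsStraightening e r f) (t : ℤ) : f [t, t] = 0 := by
  have h1 := hf [] [] t t le_rfl
  simp only [pairRHS_self, pairTerm, map_neg, Finsupp.linearCombination_single, one_smul,
    List.nil_append] at h1
  have h2 : (2 : K) • f [t, t] = 0 := by
    rw [two_smul]
    nth_rewrite 1 [h1]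
    exact neg_add_cancel _
  exact (smul_eq_zero.mp h2).resolve_left two_ne_zero

/-- Vanishing on pairs (entry in the first block, entry outside it) of an interval implies
vanishing on the opposite pairs of that interval. -/
lemma pair_eq_zero_of_swap (hf : IsStraightening e r f) (he : 2 ≤ e) (hr : 2 ≤ r) {a b : ℤ}
    (h : ∀ w ∈ Set.Ioc a b, ∀ v ∈ Set.Ioc a b, bFun e r w = 1 → bFun e r v ≠ 1 → f [w, v] = 0)
    {w v : ℤ} (hw : w ∈ Set.Ioc a b) (hv : v ∈ Set.Ioc a b) (hw1 : bFun e r w = 1)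
    (hv1 : bFun e r v ≠ 1) : f [v, w] = 0 := by
  induction hn : (v - w).natAbs using Nat.strong_induction_on generalizing w v with
  | _ n ih =>
    have key : ∀ p : ℤ × ℤ, p.1 ∈ Set.Ioc a b → p.2 ∈ Set.Ioc a b →
        (p.1 - p.2).natAbs < n →
        ((bFun e r p.1 = bFun e r v ∧ bFun e r p.2 = bFun e r w) ∨
          (bFun e r p.1 = bFun e r w ∧ bFun e r p.2 = bFun e r v)) → f [p.1, p.2] = 0 := by
      rintro ⟨x, y⟩ hx hy hlt (⟨h1, h2⟩ | ⟨h1, h2⟩)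
      · exact ih _ hlt hy hx (h2.trans hw1) (h1.trans_ne hv1) rfl
      · exact h x hx y hy (h1.trans hw1) (h2.trans_ne hv1)
    simp only [Set.mem_Ioc] at key hw hv
    rcases le_total v w with hvw | hwv
    · obtain ⟨κ, -, -, hκ⟩ := hf.exists_pair_eq_smul he hr hvw fun p hp => by
        obtain ⟨h1, h2, h3, h4⟩ := hp
        exact key p (by omega) (by omega) (by omega) (by tauto)
      rw [hκ, h w hw v hv hw1 hv1, smul_zero]
    · obtain ⟨κ, hκ0, -, hκ⟩ := hf.exists_pair_eq_smul he hr hwv fun p hp => by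
        obtain ⟨h1, h2, h3, h4⟩ := hp
        exact key p (by omega) (by omega) (by omega) (by tauto)
      rw [h w hw v hv hw1 hv1] at hκ
      exact (smul_eq_zero.mp hκ.symm).resolve_left hκ0

end IsStraightening

/-- The sum of all proper suffix sums of `L`, with entries shifted by `a`. -/
def suffixWeight (a : ℤ) : List ℤ → ℤ
  | [] => 0
  | _ :: L => suffixWeight a L + (L.map (· - a)).sum

lemma suffixWeight_nonneg {a : ℤ} {L : List ℤ} (h : ∀ x ∈ L, a ≤ x) : 0 ≤ suffixWeight a L := by
  induction L with
  | nil => simp [suffixWeight]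
  | cons x L ih =>
    have h1 : 0 ≤ (L.map (· - a)).sum := List.sum_nonneg (by
      intro y hy
      obtain ⟨z, hz, rfl⟩ := List.mem_map.mp hy
      have := h z (List.mem_cons_of_mem _ hz)
      simpa using this)
    have h2 := ih fun y hy => h y (List.mem_cons_of_mem _ hy)
    simp only [suffixWeight]
    omega

lemma suffixWeight_sub (a : ℤ) (P Q : List ℤ) {x y x' y' : ℤ} (h : x + y = x' + y') :
    suffixWeight a (P ++ x :: y :: Q) - suffixWeight a (P ++ x' :: y' :: Q) = y - y' := by
  induction P with
  | nil => simp [suffixWeight]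
  | cons z P ih =>
    simp only [List.cons_append, suffixWeight, List.map_append, List.map_cons, List.sum_append,
      List.sum_cons]
    linarith

lemma exists_adjacent_le_of_not_pairwise_gt {L : List ℤ} (h : ¬ L.Pairwise (· > ·)) :
    ∃ (P Q : List ℤ) (x y : ℤ), x ≤ y ∧ L = P ++ x :: y :: Q := by
  induction L with
  | nil => simp at h
  | cons x L ih =>
    by_cases hL : L.Pairwise (· > ·)
    · cases L with
      | nil => simp at h
      | cons y L =>
        refine ⟨[], L, x, y, ?_, rfl⟩
        by_contra! hxy
        refine h (List.pairwise_cons.mpr ⟨fun z hz => ?_, hL⟩)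
        rcases List.mem_cons.mp hz with rfl | hz
        · exact hxy
        · exact ((List.pairwise_cons.mp hL).1 z hz).trans hxy
    · obtain ⟨P, Q, x', y', hxy, rfl⟩ := ih hL
      exact ⟨x :: P, Q, x', y', hxy, rfl⟩

lemma exists_eq_append_of_pairwise_gt {x : ℤ} {V : List ℤ} (hV : V.Pairwise (· > ·))
    (hx : x ∉ V) :
    ∃ V₁ V₂ : List ℤ, V = V₁ ++ V₂ ∧ (∀ v ∈ V₁, x < v) ∧ ∀ v ∈ V₂, v < x := by
  induction V with
  | nil => exact ⟨[], [], rfl, by simp, by simp⟩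
  | cons y V ih =>
    obtain ⟨hy, hV⟩ := List.pairwise_cons.mp hV
    rcases lt_trichotomy x y with h | rfl | h
    · obtain ⟨V₁, V₂, rfl, h1, h2⟩ := ih hV (fun h' => hx (List.mem_cons_of_mem _ h'))
      exact ⟨y :: V₁, V₂, rfl, by simpa using ⟨h, h1⟩, h2⟩
    · simp at hx
    · exact ⟨[], y :: V, rfl, by simp, by simpa using ⟨h, fun v hv => (hy v hv).trans h⟩⟩

namespace IsStraightening

variable {M : Type*} [AddCommGroup M] [Module K M] {e r : ℤ} {f : List ℤ → M}

/-- A wedge with more factors than there are available entries in the first block vanishes. -/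
lemma eq_zero_of_card_lt (hf : IsStraightening e r f) (he : 2 ≤ e) (hr : 2 ≤ r) {a b : ℤ}
    {L : List ℤ} (hL : ∀ x ∈ L, x ∈ Set.Ioc a b ∧ bFun e r x = 1)
    (hcard : ((Finset.Ioc a b).filter fun x => bFun e r x = 1).card < L.length) : f L = 0 := by
  induction hn : (suffixWeight a L).toNat using Nat.strong_induction_on generalizing L with
  | _ n ih =>
    by_cases hs : L.Pairwise (· > ·)
    · have hnd : L.Nodup := hs.imp fun h => h.ne'
      have h1 : L.toFinset ⊆ (Finset.Ioc a b).filter fun x => bFun e r x = 1 := fun x hx => by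
        simpa using hL x (List.mem_toFinset.mp hx)
      have := Finset.card_le_card h1
      rw [List.toFinset_card_of_nodup hnd] at this
      omega
    · obtain ⟨P, Q, x, y, hxy, rfl⟩ := exists_adjacent_le_of_not_pairwise_gt hs
      have hg := hf.context P Q
      have hx := hL x (by simp)
      have hy := hL y (by simp)
      have step : ∀ x' y', x' ∈ Set.Ioc a b → y' ∈ Set.Ioc a b → bFun e r x' = 1 →
          bFun e r y' = 1 → x + y = x' + y' → y' < y → f (P ++ [x', y'] ++ Q) = 0 := by
        intro x' y' hx' hy' hbx hby hsum hlt
        have hL' : ∀ z ∈ P ++ [x', y'] ++ Q, z ∈ Set.Ioc a b ∧ bFun e r z = 1 := by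
          intro z hz
          simp only [List.mem_append, List.mem_cons, List.not_mem_nil, or_false] at hz hL
          rcases hz with (hz | rfl | rfl) | hz
          · exact hL z (by tauto)
          · exact ⟨hx', hbx⟩
          · exact ⟨hy', hby⟩
          · exact hL z (by tauto)
        refine ih _ ?_ hL' (by simpa using hcard) rfl
        have h1 := suffixWeight_sub a P Q hsum
        have h2 := suffixWeight_nonneg fun z hz => (hL' z hz).1.1.le
        simp only [List.append_assoc, List.cons_append, List.nil_append] at h2 ⊢
        omega
      have goal : f (P ++ [x, y] ++ Q) = 0 := by
        rcases hxy.eq_or_lt with rfl | hlt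
        · exact hg.pair_self x
        · simp only [Set.mem_Ioc] at step hx hy
          obtain ⟨κ, -, -, hκ⟩ := hg.exists_pair_eq_smul he hr hxy fun p hp => by
            obtain ⟨h1, h2, h3, h4⟩ := hp
            exact step p.1 p.2 (by omega) (by omega) (by omega) (by omega) (by omega) (by omega)
          rw [hκ, step y x hy.1 hx.1 hy.2 hx.2 (add_comm _ _) hlt, smul_zero]
      simpa using goal

/-- If `U` lists all first-block entries of `(a, b]`, then a further first-block entry of
`(a, b]` occurring after some entries outside the first block makes the wedge vanish. -/
lemma append_cons_eq_zero (hf : IsStraightening e r f) (he : 2 ≤ e) (hr : 2 ≤ r) {a b : ℤ}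
    {U : List ℤ} (hU : U.Nodup) (hU' : ∀ x, x ∈ U ↔ x ∈ Set.Ioc a b ∧ bFun e r x = 1)
    (V Q : List ℤ) (hV : ∀ v ∈ V, v ∈ Set.Ioc a b ∧ bFun e r v ≠ 1)
    {w : ℤ} (hw : w ∈ Set.Ioc a b) (hw1 : bFun e r w = 1) : f (U ++ V ++ w :: Q) = 0 := by
  induction V using List.reverseRecOn generalizing w Q with
  | nil =>
    have := (hf.context [] Q).eq_zero_of_card_lt he hr (a := a) (b := b) (L := U ++ [w])
      (fun x hx => by
        rcases List.mem_append.mp hx with hx | hx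
        · exact (hU' x).mp hx
        · rw [List.mem_singleton.mp hx]
          exact ⟨hw, hw1⟩)
      (by
        have : (Finset.Ioc a b).filter (fun x => bFun e r x = 1) = U.toFinset := by
          ext x; simp [hU']
        rw [this, List.toFinset_card_of_nodup hU]
        simp)
    simpa using this
  | append_singleton V v ih =>
    have hv := hV v (by simp)
    have hV' : ∀ v ∈ V, v ∈ Set.Ioc a b ∧ bFun e r v ≠ 1 := fun x hx => hV x (by simp [hx])
    have := (hf.context (U ++ V) Q).pair_eq_zero_of_swap he hr (a := a) (b := b)
      (fun w' hw' v' _ hw1' _ => by simpa using ih (v' :: Q) hV' hw' hw1') hw hv.1 hw1 hv.2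
    simpa using this

/-- The smallest first-block entry moves to the right across larger entries outside the
first block. -/
lemma move_right (hf : IsStraightening e r f) (he : 2 ≤ e) (hr : 2 ≤ r) {x b : ℤ}
    (hx : bFun e r x = 1) {U : List ℤ} (hU : U.Nodup)
    (hU' : ∀ y, y ∈ U ↔ y ∈ Set.Ioc x b ∧ bFun e r y = 1) (V V' Q : List ℤ)
    (hV : ∀ v ∈ V, v ∈ Set.Ioc x b ∧ bFun e r v ≠ 1)
    (hV' : ∀ v ∈ V', v ∈ Set.Ioc x b ∧ bFun e r v ≠ 1) :
    f (U ++ V ++ x :: (V' ++ Q)) =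
      (V'.map fun v => if x % e = v % e then -qK else -1).prod • f (U ++ V ++ V' ++ x :: Q) := by
  induction V' generalizing V with
  | nil => simp
  | cons v V' ih =>
    have hv := hV' v (by simp)
    have hVv : ∀ v' ∈ V ++ [v], v' ∈ Set.Ioc x b ∧ bFun e r v' ≠ 1 := fun y hy => by
      rcases List.mem_append.mp hy with hy | hy
      · exact hV y hy
      · rwa [List.mem_singleton.mp hy]
    obtain ⟨κ, -, hκ', hκ⟩ := (hf.context (U ++ V) (V' ++ Q)).exists_pair_eq_smul he hr
      hv.1.1.le (fun p hp => by
        obtain ⟨h1, h2, h3, h4⟩ := hp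
        have hvb := hv.1.2
        have hp1 : p.1 ∈ Set.Ioc x b := by simp only [Set.mem_Ioc]; omega
        have hp2 : p.2 ∈ Set.Ioc x b := by simp only [Set.mem_Ioc]; omega
        rcases h4 with ⟨h4, h5⟩ | ⟨h4, h5⟩
        · have := hf.append_cons_eq_zero he hr hU hU' (V ++ [p.1]) (V' ++ Q)
            (fun y hy => by
              rcases List.mem_append.mp hy with hy | hy
              · exact hV y hy
              · rw [List.mem_singleton.mp hy]
                exact ⟨hp1, h4.trans_ne hv.2⟩) hp2 (h5.trans hx)
          simpa using this
        · have := hf.append_cons_eq_zero he hr hU hU' V (p.2 :: (V' ++ Q)) hV hp1 (h4.trans hx)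
          simpa using this)
    have h6 := ih (V ++ [v]) hVv fun y hy => hV' y (by simp [hy])
    have hne : bFun e r x ≠ bFun e r v := by rw [hx]; exact hv.2.symm
    rw [hκ' hne] at hκ
    simp only [List.append_assoc, List.cons_append, List.nil_append] at hκ h6 ⊢
    rw [hκ, h6, List.map_cons, List.prod_cons, mul_smul]

/-- Sorting a wedge whose first part is an upper segment of first-block entries and whose
second part consists of entries outside the first block. -/
lemma exists_sorted (hf : IsStraightening e r f) (he : 2 ≤ e) (hr : 2 ≤ r) {d : ℤ}
    (U V Q : List ℤ) (hU : U.Pairwise (· > ·)) (hUd : ∀ x ∈ U, x ≤ d ∧ bFun e r x = 1)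
    (hUup : ∀ x ∈ U, ∀ y, x < y → y ≤ d → bFun e r y = 1 → y ∈ U)
    (hV : V.Pairwise (· > ·)) (hVd : ∀ v ∈ V, v ≤ d ∧ bFun e r v ≠ 1) :
    ∃ T : List ℤ, T.Pairwise (· > ·) ∧ T.Perm (U ++ V) ∧
      f (U ++ V ++ Q) = (U.map fun x => (V.map fun v =>
        if x < v then (if x % e = v % e then -qK else -1) else 1).prod).prod • f (T ++ Q) := by
  induction U using List.reverseRecOn generalizing V Q with
  | nil => exact ⟨V, hV, by simp, by simp⟩
  | append_singleton U x ih =>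
    have hxU := hUd x (by simp)
    obtain ⟨hU1, -, hUgt⟩ := List.pairwise_append.mp hU
    replace hUgt : ∀ y ∈ U, x < y := fun y hy => hUgt y hy x (by simp)
    obtain ⟨V₁, V₂, rfl, hV₁, hV₂⟩ := exists_eq_append_of_pairwise_gt hV
      fun h => (hVd x h).2 hxU.2
    obtain ⟨hVp₁, hVp₂, hVp⟩ := List.pairwise_append.mp hV
    have hU' : ∀ y, y ∈ U ↔ y ∈ Set.Ioc x d ∧ bFun e r y = 1 := fun y => by
      constructor
      · intro hy
        have := hUd y (by simp [hy])
        exact ⟨⟨hUgt y hy, this.1⟩, this.2⟩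
      · rintro ⟨⟨h1, h2⟩, h3⟩
        have := hUup x (by simp) y h1 h2 h3
        simp only [List.mem_append, List.mem_singleton] at this
        exact this.resolve_right h1.ne'
    obtain ⟨T, hT, hTp, hTf⟩ := ih V₁ (x :: (V₂ ++ Q)) hU1 (fun y hy => hUd y (by simp [hy]))
      (fun y hy z hyz hzd hz => (hU' z).mpr ⟨⟨(hUgt y hy).trans hyz, hzd⟩, hz⟩) hVp₁
      (fun y hy => hVd y (by simp [hy]))
    have hTx : ∀ y ∈ T, x < y := fun y hy => by
      rcases List.mem_append.mp (hTp.mem_iff.mp hy) with hy | hy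
      · exact hUgt y hy
      · exact hV₁ y hy
    refine ⟨T ++ x :: V₂, ?_, ?_, ?_⟩
    · refine List.pairwise_append.mpr ⟨hT, List.pairwise_cons.mpr ⟨hV₂, hVp₂⟩, fun y hy z hz => ?_⟩
      rcases List.mem_cons.mp hz with rfl | hz
      · exact hTx y hy
      · exact (hV₂ z hz).trans (hTx y hy)
    · calc (T ++ x :: V₂).Perm (U ++ V₁ ++ x :: V₂) := hTp.append_right _
        _ = U ++ (V₁ ++ x :: V₂) := by simp
        List.Perm _ (U ++ x :: (V₁ ++ V₂)) := List.perm_middle.append_left U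
        _ = U ++ [x] ++ (V₁ ++ V₂) := by simp
    · have h1 := hf.move_right he hr hxU.2 (hU1.imp fun h => h.ne') hU' [] V₁ (V₂ ++ Q) (by simp)
        fun v hv => ⟨⟨hV₁ v hv, (hVd v (by simp [hv])).1⟩, (hVd v (by simp [hv])).2⟩
      have h2 : ∀ y, x ≤ y → (V₂.map fun v =>
          if y < v then (if y % e = v % e then -qK else -1) else 1).prod = 1 := fun y hy => by
        refine List.prod_eq_one fun z hz => ?_
        obtain ⟨v, hv, rfl⟩ := List.mem_map.mp hz
        exact if_neg (by have := hV₂ v hv; omega)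
      have h3 : (V₁.map fun v =>
          if x < v then (if x % e = v % e then -qK else -1) else 1) =
          V₁.map fun v => if x % e = v % e then -qK else -1 :=
        List.map_congr_left fun v hv => if_pos (hV₁ v hv)
      have h4 : (U.map fun x => ((V₁ ++ V₂).map fun v =>
          if x < v then (if x % e = v % e then -qK else -1) else 1).prod) =
          U.map fun x => (V₁.map fun v =>
          if x < v then (if x % e = v % e then -qK else -1) else 1).prod :=
        List.map_congr_left fun y hy => by
          rw [List.map_append, List.prod_append, h2 y (hUgt y hy).le, mul_one]
      simp only [List.append_nil, List.append_assoc, List.cons_append, List.nil_append]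
        at h1 hTf ⊢
      rw [h1, hTf, List.map_append, List.prod_append, h4, List.map_singleton, List.prod_singleton,
        List.map_append, List.prod_append, h2 x le_rfl, h3, mul_one, smul_smul, mul_comm]

end IsStraightening

/-- The wedge of the entries of a list of length `l`, and zero for lists of other lengths. -/
def listWedge (e r : ℤ) (l : ℕ) (L : List ℤ) : WedgeSpace e r l :=
  if L.length = l then wedge e r l fun i => L.getD i 0 else 0

lemma updPair_getD (l : ℕ) (P Q : List ℤ) (x y : ℤ) (p : ℤ × ℤ) :
    updPair l (fun i : Fin l => (P ++ x :: y :: Q).getD i 0) P.length p =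
      fun i : Fin l => (P ++ p.1 :: p.2 :: Q).getD i 0 := by
  funext ⟨i, hi⟩
  simp only [updPair]
  rcases lt_trichotomy i P.length with h | rfl | h
  · rw [if_neg (by omega), if_neg (by omega), List.getD_append _ _ _ _ h,
      List.getD_append _ _ _ _ h]
  · rw [if_pos rfl, List.getD_append_right _ _ _ _ le_rfl]
    simp
  · rw [if_neg (by omega), List.getD_append_right _ _ _ _ h.le,
      List.getD_append_right _ _ _ _ h.le]
    obtain ⟨k, rfl⟩ := Nat.exists_eq_add_of_lt h
    rw [show P.length + k + 1 - P.length = k + 1 by omega]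
    cases k with
    | zero => simp
    | succ k =>
      rw [if_neg (by omega)]
      simp

lemma isStraightening_listWedge (e r : ℤ) (l : ℕ) : IsStraightening e r (listWedge e r l) := by
  intro P Q x y hxy
  by_cases hl : P.length + (Q.length + 2) = l
  · have hlen : ∀ p : ℤ × ℤ, (P ++ p.1 :: p.2 :: Q).length = l := fun p => by
      simpa using hl
    have hx : (P ++ x :: y :: Q).getD P.length 0 = x := by
      rw [List.getD_append_right _ _ _ _ le_rfl]; simp
    have hy : (P ++ x :: y :: Q).getD (P.length + 1) 0 = y := by
      rw [List.getD_append_right _ _ _ _ (by omega)]; simp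
    have hmem : Finsupp.single (fun i : Fin l => (P ++ x :: y :: Q).getD i 0) (1 : K) -
        ((pairRHS e r x y).sum fun p c =>
          Finsupp.single (fun i : Fin l => (P ++ p.1 :: p.2 :: Q).getD i 0) c) ∈ relSet e r l := by
      refine ⟨fun i => (P ++ x :: y :: Q).getD i 0, ⟨P.length, by omega⟩,
        ⟨P.length + 1, by omega⟩, rfl, ?_, ?_⟩
      · simpa only [hx, hy] using hxy
      · simp only [hx, hy, updPair_getD]
    have h1 := (Submodule.Quotient.eq (Submodule.span K (relSet e r l))).mpr
      (Submodule.subset_span hmem)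
    simp only [listWedge, hlen, if_true]
    rw [if_pos (hlen (x, y)), wedge, h1, Finsupp.linearCombination_apply,
      ← Submodule.mkQ_apply, Finsupp.sum, map_sum]
    refine Finset.sum_congr rfl fun p _ => ?_
    simp only [wedge, Submodule.mkQ_apply]
    rw [← Submodule.Quotient.mk_smul, Finsupp.smul_single, smul_eq_mul, mul_one]
  · have hlen : ∀ p : ℤ × ℤ, (P ++ p.1 :: p.2 :: Q).length ≠ l := fun p => by
      simpa using hl
    simp only [listWedge, hlen, if_false]
    rw [if_neg (hlen (x, y)), Finsupp.linearCombination_apply]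
    simp

lemma listWedge_ofFn (e r : ℤ) (l : ℕ) (t : Fin l → ℤ) :
    listWedge e r l (List.ofFn t) = wedge e r l t := by
  rw [listWedge, if_pos (List.length_ofFn)]
  congr 1
  funext i
  simp

lemma listWedge_ofFn_append_ofFn (e r : ℤ) (n m : ℕ) (u : Fin n → ℤ) (v : Fin m → ℤ) :
    listWedge e r (m + n) (List.ofFn u ++ List.ofFn v) = wedge e r (m + n) (concatFwd n m u v) := by
  rw [listWedge, if_pos (by simp [add_comm])]
  congr 1
  funext i
  unfold concatFwd
  split_ifs with h
  · rw [List.getD_append _ _ _ _ (by simpa using h)]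
    simp [h]
  · have h' : (i : ℕ) - n < m := by have := i.2; omega
    rw [List.getD_append_right _ _ _ _ (by simpa using h)]
    simp [h']

lemma prod_swap_scalars (e r c d v : ℤ) (hvd : v ≤ d) (hv : bFun e r v ≠ 1) :
    ∏ x ∈ (Finset.Icc c d).filter (fun x => bFun e r x = 1),
        (if x < v then (if x % e = v % e then -qK else -1) else 1) =
      (-1 : K) ^ Xc e r c v * qK ^ Yc e r c v := by
  rw [← Finset.prod_filter, Finset.filter_filter]
  have h1 : (Finset.Icc c d).filter (fun x => bFun e r x = 1 ∧ x < v) =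
      (Finset.Icc c v).filter fun x => bFun e r x = 1 := by
    ext x
    simp only [Finset.mem_filter, Finset.mem_Icc]
    constructor
    · rintro ⟨h1, h2, h3⟩
      exact ⟨⟨h1.1, h3.le⟩, h2⟩
    · rintro ⟨h1, h2⟩
      have : x ≠ v := by rintro rfl; exact hv h2
      exact ⟨⟨h1.1, h1.2.trans hvd⟩, h2, lt_of_le_of_ne h1.2 this⟩
  have h2 : ∀ x : ℤ, (if x % e = v % e then -qK else -1 : K) =
      -1 * if x % e = v % e then qK else 1 := fun x => by split_ifs <;> simp
  rw [h1, Finset.prod_congr rfl fun x _ => h2 x, Finset.prod_mul_distrib, Finset.prod_const,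
    ← Finset.prod_filter, Finset.filter_filter, Finset.prod_const, Xc, Yc]

/-- With `u₁ > … > u_n` the elements of `{c,…,d} ∩ 𝟙_r`,
`v₁ > … > v_m` elements of `{c,…,d} ∖ 𝟙_r`, and `t₁ > … > t_{m+n}` the elements of
`{v₁,…,v_m} ∪ {u₁,…,u_n}`, one has in `Λ^{m+n}_{e,r}`:
`|u₁⟩∧…∧|u_n⟩∧|v₁⟩∧…∧|v_m⟩ = (Π_i (−1)^{X_c(v_i)} q^{Y_c(v_i)}) |t₁⟩∧…∧|t_{m+n}⟩`. -/
theorem wedge_u_then_v_eq (e r : ℤ) (he : 2 ≤ e) (hr : 2 ≤ r)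
    (c d : ℤ) (hcd : c ≤ d) (n m : ℕ)
    (u : Fin n → ℤ) (hu : StrictAnti u)
    (huset : Set.range u = {x : ℤ | x ∈ Set.Icc c d ∧ bFun e r x = 1})
    (v : Fin m → ℤ) (hv : StrictAnti v)
    (hvmem : ∀ i, v i ∈ Set.Icc c d ∧ bFun e r (v i) ≠ 1)
    (t : Fin (m + n) → ℤ) (ht : StrictAnti t)
    (htset : Set.range t = Set.range v ∪ Set.range u) :
    wedge e r (m + n) (concatFwd n m u v) =
      (∏ i : Fin m, ((-1 : K) ^ Xc e r c (v i) * qK ^ Yc e r c (v i))) •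
        wedge e r (m + n) t := by
  have hU : (List.ofFn u).Pairwise (· > ·) := List.pairwise_ofFn.mpr fun _ _ h => hu h
  have hV : (List.ofFn v).Pairwise (· > ·) := List.pairwise_ofFn.mpr fun _ _ h => hv h
  have hT : (List.ofFn t).Pairwise (· > ·) := List.pairwise_ofFn.mpr fun _ _ h => ht h
  have huset' : ∀ x, x ∈ Set.range u ↔ x ∈ Set.Icc c d ∧ bFun e r x = 1 := fun x => by
    rw [huset, Set.mem_ofPred_eq]
  obtain ⟨T, hTs, hTp, hTf⟩ := (isStraightening_listWedge e r (m + n)).exists_sorted he hr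
    (d := d) (List.ofFn u) (List.ofFn v) [] hU
    (fun x hx => by
      have := (huset' x).mp ((List.mem_ofFn' u x).mp hx)
      exact ⟨this.1.2, this.2⟩)
    (fun x hx y hxy hyd hy => by
      have := (huset' x).mp ((List.mem_ofFn' u x).mp hx)
      exact (List.mem_ofFn' u y).mpr ((huset' y).mpr ⟨⟨this.1.1.trans hxy.le, hyd⟩, hy⟩))
    hV
    (fun x hx => by
      obtain ⟨i, rfl⟩ := (List.mem_ofFn' v x).mp hx
      exact ⟨(hvmem i).1.2, (hvmem i).2⟩)
  have hTt : T = List.ofFn t := by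
    refine List.Perm.eq_of_pairwise' hTs hT ?_
    refine (List.perm_ext_iff_of_nodup (hTs.imp fun h => h.ne') (hT.imp fun h => h.ne')).mpr
      fun x => ?_
    rw [hTp.mem_iff, List.mem_append, List.mem_ofFn', List.mem_ofFn', List.mem_ofFn', htset,
      Set.mem_union, or_comm]
  rw [List.append_nil, List.append_nil, hTt, listWedge_ofFn, listWedge_ofFn_append_ofFn] at hTf
  rw [hTf]
  congr 1
  simp only [List.map_ofFn, List.prod_ofFn, Function.comp_apply]
  rw [Finset.prod_comm]
  refine Finset.prod_congr rfl fun i _ => ?_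
  have himage : (Finset.Icc c d).filter (fun x => bFun e r x = 1) = Finset.univ.image u := by
    ext x
    rw [Finset.mem_filter, Finset.mem_Icc, ← Set.mem_Icc, ← huset' x]
    simp
  rw [← prod_swap_scalars e r c d (v i) (hvmem i).1.2 (hvmem i).2, himage,
    Finset.prod_image hu.injective.injOn]

end
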